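/- There do not exist quaternions u₂, u₃, u₄, u₅, each of norm 1/2, and integers p₁, p₂ with 0 < p₁ < p₂, such that Re(conj(u₂)·u₃) = 0, Re(conj(u₄)·u₅) = 0, and p₁·(conj(u₂)·u₃ − conj(u₃)·u₂) + p₂·(conj(u₄)·u₅ − conj(u₅)·u₄) = 0. -/

import Mathlib

open Quaternion

/-- If `conj(a)b` is purely imaginary, then `conj(a)b - conj(b)a = 2 conj(a)b` has norm `1/2`. -/
lemma norm_pair (a b : ℍ[ℝ]) (ha : ‖a‖ = 1 / 2) (hb : ‖b‖ = 1 / 2)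
    (h : (star a * b).re = 0) : ‖star a * b - star b * a‖ = 1 / 2 := by
  have h1 : star b * a = -(star a * b) := by
    have h2 : star (star a * b) = -(star a * b) := Quaternion.star_eq_neg.mpr h
    rwa [star_mul, star_star] at h2
  rw [h1, sub_neg_eq_add, ← two_smul ℝ, norm_smul, norm_mul, norm_star, ha, hb]
  norm_num

lemma norm_int_quat (p : ℤ) : ‖(p : ℍ[ℝ])‖ = |(p : ℝ)| := by
  rw [← Quaternion.coe_intCast, Quaternion.norm_coe, Real.norm_eq_abs]

/-- The key step of Lemma 2.7 of the paper (case of two quaternionic pairs): there are no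
quaternions `u₂, u₃, u₄, u₅` of norm `1/2` with `Re(conj(u₂)u₃) = Re(conj(u₄)u₅) = 0`
satisfying the weighted moment map equation
`p₁(conj(u₂)u₃ - conj(u₃)u₂) + p₂(conj(u₄)u₅ - conj(u₅)u₄) = 0` for integers `0 < p₁ < p₂`. -/
theorem no_two_pair_vertex :
    ¬ ∃ (u₂ u₃ u₄ u₅ : ℍ[ℝ]) (p₁ p₂ : ℤ),
      0 < p₁ ∧ p₁ < p₂ ∧
      ‖u₂‖ = 1 / 2 ∧ ‖u₃‖ = 1 / 2 ∧ ‖u₄‖ = 1 / 2 ∧ ‖u₅‖ = 1 / 2 ∧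
      (star u₂ * u₃).re = 0 ∧ (star u₄ * u₅).re = 0 ∧
      (p₁ : ℍ[ℝ]) * (star u₂ * u₃ - star u₃ * u₂) +
        (p₂ : ℍ[ℝ]) * (star u₄ * u₅ - star u₅ * u₄) = 0 := by
  rintro ⟨a, b, c, d, p, q, hp, hpq, ha, hb, hc, hd, hab, hcd, h⟩
  have h1 := congrArg norm (eq_neg_of_add_eq_zero_left h)
  rw [norm_neg, norm_mul, norm_mul, norm_pair a b ha hb hab, norm_pair c d hc hd hcd,
    norm_int_quat, norm_int_quat] at h1
  have hp' : (0 : ℝ) < p := by exact_mod_cast hp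
  have hpq' : (p : ℝ) < q := by exact_mod_cast hpq
  rw [abs_of_pos hp', abs_of_pos (hp'.trans hpq')] at h1
  linarith
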